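/- Let β ∈ (0, d], suppose Γ contains an Ahlfors point with exponent β, and let δ ≥ 0 with δ ≠ 2 − β. If for some r > 0 and a > 0 the boundary Hardy inequality with constant a holds on Γ_r, then a ≥ 2/|β + δ − 2|; in particular a_δ(Γ) ≥ 2/|β + δ − 2| (with β = d − d_H for a boundary of Hausdorff dimension d_H). -/

import Mathlib

open MeasureTheory Metric Set ENNReal RealInnerProductSpace

noncomputable section

/-- The Euclidean distance from `x` to the boundary `Γ = ∂Ω` of `Ω`. -/
def distB {d : ℕ} (Ω : Set (EuclideanSpace ℝ (Fin d))) (x : EuclideanSpace ℝ (Fin d)) : ℝ :=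
  Metric.infDist x (frontier Ω)

/-- The boundary layer `Γ_r = {x ∈ Ω : d_Γ(x) < r}`. -/
def bdryLayer {d : ℕ} (Ω : Set (EuclideanSpace ℝ (Fin d))) (r : ℝ) :
    Set (EuclideanSpace ℝ (Fin d)) :=
  {x | x ∈ Ω ∧ distB Ω x < r}

/-- `C_c^1` real functions with compact support contained in `U`. -/
def IsCc1 {d : ℕ} (U : Set (EuclideanSpace ℝ (Fin d)))
    (ψ : EuclideanSpace ℝ (Fin d) → ℝ) : Prop :=
  ContDiff ℝ 1 ψ ∧ HasCompactSupport ψ ∧ tsupport ψ ⊆ U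

/-- The `L²` norm with respect to Lebesgue measure. -/
def L2N {d : ℕ} (f : EuclideanSpace ℝ (Fin d) → ℝ) : ℝ≥0∞ :=
  eLpNorm f 2 volume

/-- The weighted norm `‖d_Γ^p ψ‖₂`. -/
def wNorm {d : ℕ} (Ω : Set (EuclideanSpace ℝ (Fin d))) (p : ℝ)
    (ψ : EuclideanSpace ℝ (Fin d) → ℝ) : ℝ≥0∞ :=
  L2N (fun x => distB Ω x ^ p * ψ x)

/-- The weighted gradient norm `‖d_Γ^p |∇ψ|‖₂`. -/
def wGradNorm {d : ℕ} (Ω : Set (EuclideanSpace ℝ (Fin d))) (p : ℝ)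
    (ψ : EuclideanSpace ℝ (Fin d) → ℝ) : ℝ≥0∞ :=
  L2N (fun x => distB Ω x ^ p * ‖fderiv ℝ ψ x‖)

/-- The (boundary) Hardy inequality `‖d_Γ^{δ/2-1}ψ‖₂ ≤ a ‖d_Γ^{δ/2}|∇ψ|‖₂`
with constant `a` for all test functions `ψ ∈ C_c^1(S)`. -/
def BHardy {d : ℕ} (Ω : Set (EuclideanSpace ℝ (Fin d))) (δ : ℝ)
    (S : Set (EuclideanSpace ℝ (Fin d))) (a : ℝ) : Prop :=
  ∀ ψ, IsCc1 S ψ → wNorm Ω (δ/2 - 1) ψ ≤ ENNReal.ofReal a * wGradNorm Ω (δ/2) ψ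

/-- The weak Hardy inequality `‖d_Γ^{δ/2-1}ψ‖₂ ≤ b ‖d_Γ^{δ/2}|∇ψ|‖₂ + c ‖ψ‖₂`
with constants `b, c` for all test functions `ψ ∈ C_c^1(S)`. -/
def WHardy {d : ℕ} (Ω : Set (EuclideanSpace ℝ (Fin d))) (δ : ℝ)
    (S : Set (EuclideanSpace ℝ (Fin d))) (b c : ℝ) : Prop :=
  ∀ ψ, IsCc1 S ψ →
    wNorm Ω (δ/2 - 1) ψ ≤ ENNReal.ofReal b * wGradNorm Ω (δ/2) ψ + ENNReal.ofReal c * L2N ψ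

/-- The optimal Hardy constant for test functions supported in `S`
(the infimum of the `a > 0` for which the Hardy inequality holds on `S`;
`∞` if there is no such constant). -/
def hardyConstS {d : ℕ} (Ω : Set (EuclideanSpace ℝ (Fin d))) (δ : ℝ)
    (S : Set (EuclideanSpace ℝ (Fin d))) : ℝ≥0∞ :=
  sInf {t | ∃ a : ℝ, 0 < a ∧ t = ENNReal.ofReal a ∧ BHardy Ω δ S a}

/-- The boundary Hardy constant `a_δ(Γ) = inf_{r>0} a_δ(Γ_r)`. -/
def hardyConst {d : ℕ} (Ω : Set (EuclideanSpace ℝ (Fin d))) (δ : ℝ) : ℝ≥0∞ :=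
  ⨅ (r : ℝ) (_ : 0 < r), hardyConstS Ω δ (bdryLayer Ω r)

/-- The local boundary Hardy constant `a_δ(Γ ∩ U) = inf_{r>0} a_δ(Γ_r ∩ U)`. -/
def hardyConstOn {d : ℕ} (Ω : Set (EuclideanSpace ℝ (Fin d))) (δ : ℝ)
    (U : Set (EuclideanSpace ℝ (Fin d))) : ℝ≥0∞ :=
  ⨅ (r : ℝ) (_ : 0 < r), hardyConstS Ω δ (bdryLayer Ω r ∩ U)

/-- The weak Hardy constant `b_δ(Ω)`: the infimum of the `b > 0` for which there
is a `c > 0` such that the weak Hardy inequality holds on `Ω`. -/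
def weakConstDomain {d : ℕ} (Ω : Set (EuclideanSpace ℝ (Fin d))) (δ : ℝ) : ℝ≥0∞ :=
  sInf {t | ∃ b c : ℝ, 0 < b ∧ 0 < c ∧ t = ENNReal.ofReal b ∧ WHardy Ω δ Ω b c}

/-- The weak Hardy constant `b_δ(Γ)`: the infimum of the `b > 0` for which there
are `r > 0` and `c > 0` such that the weak Hardy inequality holds on `Γ_r`. -/
def weakConstBdry {d : ℕ} (Ω : Set (EuclideanSpace ℝ (Fin d))) (δ : ℝ) : ℝ≥0∞ :=
  sInf {t | ∃ b c r : ℝ, 0 < b ∧ 0 < c ∧ 0 < r ∧ t = ENNReal.ofReal b ∧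
    WHardy Ω δ (bdryLayer Ω r) b c}

/-- The weak Hardy constant `b_δ(Γ ∩ U)`. -/
def weakConstOn {d : ℕ} (Ω : Set (EuclideanSpace ℝ (Fin d))) (δ : ℝ)
    (U : Set (EuclideanSpace ℝ (Fin d))) : ℝ≥0∞ :=
  sInf {t | ∃ b c r : ℝ, 0 < b ∧ 0 < c ∧ 0 < r ∧ t = ENNReal.ofReal b ∧
    WHardy Ω δ (bdryLayer Ω r ∩ U) b c}

/-- A domain: a nonempty open connected proper subset of `ℝ^d`. -/
def IsDomainSet {d : ℕ} (Ω : Set (EuclideanSpace ℝ (Fin d))) : Prop :=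
  IsOpen Ω ∧ IsConnected Ω ∧ Ω ≠ Set.univ

/-- The (open) `r`-enlargement `A_r = {y ∈ Ω̄ : dist(y,A) < r}` of a set `A` within `Ω̄`. -/
def enlarge {d : ℕ} (Ω : Set (EuclideanSpace ℝ (Fin d)))
    (A : Set (EuclideanSpace ℝ (Fin d))) (r : ℝ) : Set (EuclideanSpace ℝ (Fin d)) :=
  {y | y ∈ closure Ω ∧ Metric.infDist y A < r}

/-- `x ∈ Γ` is an Ahlfors point with exponent `β`: for all sufficiently small `s > 0`,
setting `A = Γ ∩ B(x;s)`, there are `κ, κ' > 0` with `κ' r^β ≤ |A_r| ≤ κ r^β` for all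
sufficiently small `r > 0`. -/
def AhlforsPoint {d : ℕ} (Ω : Set (EuclideanSpace ℝ (Fin d))) (β : ℝ)
    (x : EuclideanSpace ℝ (Fin d)) : Prop :=
  x ∈ frontier Ω ∧
  ∃ s₀ > (0:ℝ), ∀ s ∈ Set.Ioo (0:ℝ) s₀,
    ∃ κ κ' : ℝ, 0 < κ ∧ 0 < κ' ∧ ∃ r₀ > (0:ℝ), ∀ r ∈ Set.Ioo (0:ℝ) r₀,
      ENNReal.ofReal (κ' * r ^ β)
          ≤ volume (enlarge Ω (frontier Ω ∩ Metric.ball x s) r) ∧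
      volume (enlarge Ω (frontier Ω ∩ Metric.ball x s) r)
          ≤ ENNReal.ofReal (κ * r ^ β)

open Filter Topology

lemma infDist_compl_eq_infDist_frontier {E : Type*} [NormedAddCommGroup E] [NormedSpace ℝ E]
    [FiniteDimensional ℝ E] {s : Set E} (hs : s ≠ univ) {y : E} (hy : y ∈ s) :
    infDist y sᶜ = infDist y (frontier s) := by
  obtain ⟨z, hz, hyz⟩ := exists_mem_frontier_infDist_compl_eq_dist hy hs
  refine le_antisymm ?_ (hyz ▸ infDist_le_dist_of_mem hz)
  rw [← infDist_closure]
  refine infDist_le_infDist_of_subset ?_ ⟨z, hz⟩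
  rw [← frontier_compl]
  exact frontier_subset_closure

/-- A `1`-Lipschitz function can be approximated uniformly by smooth `1`-Lipschitz functions. -/
lemma LipschitzWith.exists_contDiff_approx {E : Type*} [NormedAddCommGroup E]
    [InnerProductSpace ℝ E] [FiniteDimensional ℝ E] [MeasurableSpace E] [BorelSpace E]
    {f : E → ℝ} (hf : LipschitzWith 1 f) {ε : ℝ} (hε : 0 < ε) :
    ∃ g : E → ℝ, ContDiff ℝ 1 g ∧ LipschitzWith 1 g ∧ ∀ y, |g y - f y| ≤ ε := by
  let φ : ContDiffBump (0 : E) := ⟨ε / 2, ε, half_pos hε, half_lt_self hε⟩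
  have hconv : ∀ y, Integrable (fun t => φ.normed volume t • f (y - t)) volume := fun y =>
    ((φ.continuous_normed.smul (hf.continuous.comp (by fun_prop))).integrable_of_hasCompactSupport
      φ.hasCompactSupport_normed.smul_right)
  refine ⟨MeasureTheory.convolution (φ.normed volume) f (ContinuousLinearMap.lsmul ℝ ℝ) volume,
    ?_, ?_, fun y => ?_⟩
  · exact_mod_cast φ.hasCompactSupport_normed.contDiff_convolution_left (n := 1) _
      φ.contDiff_normed hf.continuous.locallyIntegrable
  · refine LipschitzWith.of_dist_le_mul fun y z => ?_
    rw [convolution_lsmul, convolution_lsmul, Real.dist_eq, ← integral_sub (hconv y) (hconv z)]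
    calc |∫ t, (φ.normed volume t • f (y - t) - φ.normed volume t • f (z - t))|
        ≤ ∫ t : E, φ.normed volume t * dist y z := by
          rw [← Real.norm_eq_abs]
          refine norm_integral_le_of_norm_le ((φ.integrable_normed (μ := volume)).mul_const _)
            (Eventually.of_forall fun t => ?_)
          rw [← smul_sub, norm_smul, Real.norm_eq_abs, abs_of_nonneg (φ.nonneg_normed t)]
          refine mul_le_mul_of_nonneg_left ?_ (φ.nonneg_normed t)
          have := hf.dist_le_mul (y - t) (z - t)
          simpa [Real.dist_eq] using this
      _ = ((1 : NNReal) : ℝ) * dist y z := by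
          rw [integral_mul_const, φ.integral_normed]; simp
  · rw [← Real.dist_eq]
    refine φ.dist_normed_convolution_le hf.continuous.aestronglyMeasurable fun x hx => ?_
    refine (hf.dist_le_mul x y).trans ?_
    simpa using (mem_ball.1 hx).le

/-- `C¹` cutoff functions on `(0, ∞)` equal to `1` on `[2τ, ρ]` and supported in `[τ, 2ρ]`, with
`t u'(t)` bounded uniformly in `τ` and `ρ`. -/
lemma exists_cutoff : ∃ C : ℝ, 0 < C ∧ ∀ τ ρ : ℝ, 0 < τ → 0 < ρ → ∃ u : ℝ → ℝ, ContDiff ℝ 1 u ∧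
    (∀ t, 0 ≤ u t) ∧ (∀ t, u t ≤ 1) ∧ (∀ t, t ≤ τ → u t = 0) ∧ (∀ t, 2 * ρ ≤ t → u t = 0) ∧
    (∀ t, 2 * τ ≤ t → t ≤ ρ → u t = 1) ∧ (∀ t, 0 < t → |t * deriv u t| ≤ C) ∧
    (∀ t, deriv u t ≠ 0 → t ∈ Icc τ (2 * τ) ∪ Icc ρ (2 * ρ)) := by
  let T := Real.smoothTransition
  have hT : ContDiff ℝ 1 T := Real.smoothTransition.contDiff (n := 1)
  have hTd : ∀ s, HasDerivAt T (deriv T s) s := fun s =>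
    (hT.differentiable (by norm_num) s).hasDerivAt
  have h0 : ∀ s, s ∉ Icc (0 : ℝ) 1 → deriv T s = 0 := by
    intro s hs
    rcases not_and_or.1 hs with h | h
    · have : T =ᶠ[𝓝 s] fun _ => (0 : ℝ) := by
        filter_upwards [Iio_mem_nhds (not_le.1 h)] with y hy
          using Real.smoothTransition.zero_of_nonpos (le_of_lt hy)
      rw [this.deriv_eq, deriv_const]
    · have : T =ᶠ[𝓝 s] fun _ => (1 : ℝ) := by
        filter_upwards [Ioi_mem_nhds (not_le.1 h)] with y hy
          using Real.smoothTransition.one_of_one_le (le_of_lt hy)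
      rw [this.deriv_eq, deriv_const]
  obtain ⟨M, hM⟩ := isCompact_Icc.exists_bound_of_continuousOn (s := Icc (0 : ℝ) 1)
    (hT.continuous_deriv le_rfl).continuousOn
  have hM0 : 0 ≤ M := (norm_nonneg _).trans (hM 0 (by simp))
  have hMt : ∀ s c, 0 ≤ c → (s ∈ Icc (0 : ℝ) 1 → c ≤ 2) → c * |deriv T s| ≤ 2 * M := by
    intro s c hc h
    by_cases hs : s ∈ Icc (0 : ℝ) 1
    · exact mul_le_mul (h hs) (hM s hs) (abs_nonneg _) (by norm_num)
    · rw [h0 s hs]; simpa using hM0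
  refine ⟨4 * M + 1, by linarith, fun τ ρ hτ hρ => ?_⟩
  let u : ℝ → ℝ := fun t => T (t / τ - 1) * T (2 - t / ρ)
  have hu : ∀ t, HasDerivAt u (deriv T (t / τ - 1) * (1 / τ) * T (2 - t / ρ)
      + T (t / τ - 1) * (deriv T (2 - t / ρ) * (-(1 / ρ)))) t := by
    intro t
    have h1 : HasDerivAt (fun t : ℝ => t / τ - 1) (1 / τ) t :=
      ((hasDerivAt_id t).div_const τ).sub_const 1
    have h2 : HasDerivAt (fun t : ℝ => 2 - t / ρ) (-(1 / ρ)) t :=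
      ((hasDerivAt_id t).div_const ρ).const_sub 2
    exact ((hTd _).comp t h1).mul ((hTd _).comp t h2)
  have hT0 : ∀ s, 0 ≤ T s := Real.smoothTransition.nonneg
  have hT1 : ∀ s, T s ≤ 1 := Real.smoothTransition.le_one
  refine ⟨u, ?_, fun t => mul_nonneg (hT0 _) (hT0 _), fun t => mul_le_one₀ (hT1 _) (hT0 _) (hT1 _),
    fun t ht => ?_, fun t ht => ?_, fun t ht ht' => ?_, fun t ht => ?_, fun t ht => ?_⟩
  · exact (hT.comp (by fun_prop)).mul (hT.comp (by fun_prop))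
  · have : T (t / τ - 1) = 0 := Real.smoothTransition.zero_of_nonpos (by
      rw [sub_nonpos, div_le_one hτ]; exact ht)
    simp [u, this]
  · have : T (2 - t / ρ) = 0 := Real.smoothTransition.zero_of_nonpos (by
      rw [sub_nonpos, le_div_iff₀ hρ]; exact ht)
    simp [u, this]
  · have h1 : T (t / τ - 1) = 1 := Real.smoothTransition.one_of_one_le (by
      rw [le_sub_iff_add_le, le_div_iff₀ hτ]; linarith)
    have h2 : T (2 - t / ρ) = 1 := Real.smoothTransition.one_of_one_le (by
      have : t / ρ ≤ 1 := (div_le_one hρ).2 ht'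
      linarith)
    simp [u, h1, h2]
  · rw [(hu t).deriv]
    have e1 := hMt (t / τ - 1) (t / τ) (by positivity) (fun h => by linarith [h.2])
    have e2 := hMt (2 - t / ρ) (t / ρ) (by positivity) (fun h => by linarith [h.1])
    have : t * (deriv T (t / τ - 1) * (1 / τ) * T (2 - t / ρ)
        + T (t / τ - 1) * (deriv T (2 - t / ρ) * (-(1 / ρ))))
        = (t / τ * deriv T (t / τ - 1)) * T (2 - t / ρ)
          - T (t / τ - 1) * (t / ρ * deriv T (2 - t / ρ)) := by ring
    rw [this]
    refine (abs_sub _ _).trans ?_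
    rw [abs_mul, abs_mul, abs_mul, abs_mul, abs_of_nonneg (hT0 (2 - t / ρ)),
      abs_of_nonneg (hT0 (t / τ - 1)), abs_of_pos (div_pos ht hτ), abs_of_pos (div_pos ht hρ)]
    have f1 := mul_le_of_le_one_right
      (show 0 ≤ t / τ * |deriv T (t / τ - 1)| by positivity) (hT1 (2 - t / ρ))
    have f2 := mul_le_of_le_one_left
      (show 0 ≤ t / ρ * |deriv T (2 - t / ρ)| by positivity) (hT1 (t / τ - 1))
    linarith
  · rw [(hu t).deriv] at ht
    by_contra hcon
    rw [mem_union, not_or] at hcon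
    apply ht
    rw [h0 (t / τ - 1), h0 (2 - t / ρ)]
    · simp
    · refine fun h => hcon.2 ⟨?_, ?_⟩
      · have := h.2
        exact (one_le_div hρ).1 (by linarith)
      · have := h.1
        exact (div_le_iff₀ hρ).1 (by linarith)
    · refine fun h => hcon.1 ⟨?_, ?_⟩
      · have := h.1
        exact (one_le_div hτ).1 (by linarith)
      · have := h.2
        exact (div_le_iff₀ hτ).1 (by linarith)

lemma AhlforsPoint.exists_measure_bounds {d : ℕ} {Ω : Set (EuclideanSpace ℝ (Fin d))}
    {β : ℝ} (hβ : 0 < β) {x : EuclideanSpace ℝ (Fin d)} (hx : AhlforsPoint Ω β x) :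
    ∃ s κ κ' t₀ : ℝ, 0 < s ∧ 0 < κ ∧ 0 < κ' ∧ 0 < t₀ ∧ ∀ t ∈ Ioo 0 t₀,
      volume {y | y ∈ Ω ∧ dist y x < 3 * s ∧ distB Ω y < t} ≤ ENNReal.ofReal (κ * t ^ β) ∧
      ENNReal.ofReal (κ' * t ^ β) ≤ volume {y | y ∈ Ω ∧ dist y x < 2 * s ∧ distB Ω y < t} := by
  obtain ⟨hxF, s₀, hs₀, H⟩ := hx
  obtain ⟨s, hs0, hs⟩ : ∃ s, 0 < s ∧ 4 * s < s₀ := ⟨s₀ / 5, by positivity, by linarith⟩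
  obtain ⟨κ, _, hκ, -, r₁, hr₁, H₁⟩ := H (4 * s) ⟨by positivity, hs⟩
  obtain ⟨_, κ', -, hκ', r₂, hr₂, H₂⟩ := H s ⟨hs0, by linarith⟩
  have hne : ∀ σ, 0 < σ → (frontier Ω ∩ ball x σ).Nonempty := fun σ hσ =>
    ⟨x, hxF, mem_ball_self hσ⟩
  have hnull : volume (frontier Ω ∩ ball x (4 * s)) = 0 := by
    refine le_antisymm (ge_of_tendsto (x := 𝓝[>] (0 : ℝ))
      (f := fun t => ENNReal.ofReal (κ * t ^ β)) ?_ ?_) zero_le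
    · have : Tendsto (fun t : ℝ => ENNReal.ofReal (κ * t ^ β)) (𝓝 0)
          (𝓝 (ENNReal.ofReal (κ * 0 ^ β))) :=
        (ENNReal.continuous_ofReal.tendsto _).comp
          (((Real.continuousAt_rpow_const 0 β (Or.inr hβ.le)).tendsto).const_mul κ)
      rw [Real.zero_rpow hβ.ne', mul_zero, ENNReal.ofReal_zero] at this
      exact this.mono_left nhdsWithin_le_nhds
    · filter_upwards [Ioo_mem_nhdsGT hr₁] with t ht
      refine (measure_mono fun y hy => ?_).trans (H₁ t ht).2
      exact ⟨frontier_subset_closure hy.1, by rw [infDist_zero_of_mem hy]; exact ht.1⟩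
  refine ⟨s, κ, κ', min s (min r₁ r₂), hs0, hκ, hκ', by positivity, fun t ht => ?_⟩
  have hts : t < s := ht.2.trans_le (min_le_left _ _)
  have ht1 : t < r₁ := ht.2.trans_le ((min_le_right _ _).trans (min_le_left _ _))
  have ht2 : t < r₂ := ht.2.trans_le ((min_le_right _ _).trans (min_le_right _ _))
  constructor
  · refine (measure_mono fun y hy => ?_).trans (H₁ t ⟨ht.1, ht1⟩).2
    obtain ⟨hy1, hy2, hy3⟩ := hy
    obtain ⟨z, hz, hyz⟩ := (infDist_lt_iff ⟨x, hxF⟩).1 hy3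
    refine ⟨subset_closure hy1, (infDist_lt_iff (hne _ (by positivity))).2 ⟨z, ⟨hz, ?_⟩, hyz⟩⟩
    have := dist_triangle_left z x y
    rw [mem_ball]; linarith
  · refine (H₂ t ⟨ht.1, ht2⟩).1.trans ?_
    rw [← add_zero (volume {y | y ∈ Ω ∧ dist y x < 2 * s ∧ distB Ω y < t}), ← hnull]
    refine (measure_mono fun y hy => ?_).trans (measure_union_le _ _)
    obtain ⟨z, hz, hyz⟩ := (infDist_lt_iff (hne _ hs0)).1 hy.2
    have h2 := dist_triangle y z x
    have h3 := mem_ball.1 hz.2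
    by_cases hyF : y ∈ frontier Ω
    · exact Or.inr ⟨hyF, by rw [mem_ball]; linarith⟩
    · refine Or.inl ⟨?_, by linarith, (infDist_lt_iff ⟨x, hxF⟩).2 ⟨z, hz.1, hyz⟩⟩
      have := closure_eq_self_union_frontier Ω ▸ hy.1
      exact this.resolve_right hyF

lemma L2N_sq {d : ℕ} (f : EuclideanSpace ℝ (Fin d) → ℝ) :
    L2N f ^ 2 = ∫⁻ y, ENNReal.ofReal (f y ^ 2) := by
  have h := eLpNorm_nnreal_pow_eq_lintegral (μ := volume) (f := f) (p := 2) two_ne_zero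
  norm_num at h
  rw [L2N, h]
  refine lintegral_congr fun y => ?_
  rw [← sq_abs, ENNReal.ofReal_pow (abs_nonneg _), ← Real.enorm_eq_ofReal_abs]

/-- Approximating the distance to `Ωᶜ` by smooth functions, a Hardy inequality on a boundary layer
extends to products of a `C¹` function with a function of the distance to the boundary. -/
lemma BHardy.comp_infDist_le {d : ℕ} {Ω : Set (EuclideanSpace ℝ (Fin d))}
    (hΩ' : Ω ≠ univ) {δ r a : ℝ} (hδ : 0 ≤ δ) (ha : 0 < a) (hH : BHardy Ω δ (bdryLayer Ω r) a)
    {F : ℝ → ℝ} (hF : ContDiff ℝ 1 F) {τ ρ : ℝ} (hτ : 0 < τ) (hρ : ρ < r)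
    (hFτ : ∀ t, t ≤ τ → F t = 0) (hFρ : ∀ t, ρ ≤ t → F t = 0)
    {η : EuclideanSpace ℝ (Fin d) → ℝ} (hη : ContDiff ℝ 1 η) (hηc : HasCompactSupport η) :
    ∫⁻ y, ENNReal.ofReal ((infDist y Ωᶜ ^ (δ / 2 - 1) * (η y * F (infDist y Ωᶜ))) ^ 2) ≤
      ENNReal.ofReal (a ^ 2) * ∫⁻ y, ENNReal.ofReal ((infDist y Ωᶜ ^ (δ / 2) *
        (|η y| * |deriv F (infDist y Ωᶜ)| + ‖fderiv ℝ η y‖ * |F (infDist y Ωᶜ)|)) ^ 2) := by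
  set Z : EuclideanSpace ℝ (Fin d) → ℝ := fun y => infDist y Ωᶜ with hZ
  have hZL : LipschitzWith 1 Z := lipschitz_infDist_pt _
  have hZc : Continuous Z := hZL.continuous
  have hZ0 : ∀ y, y ∉ Ω → Z y = 0 := fun y hy => infDist_zero_of_mem hy
  have hZd : ∀ y ∈ Ω, distB Ω y = Z y := fun y hy =>
    (infDist_compl_eq_infDist_frontier hΩ' hy).symm
  have hε : ∀ n : ℕ, (0 : ℝ) < 1 / ((n : ℝ) + 1) := fun n => by positivity
  choose D hD1 hD2 hD3 using fun n : ℕ => hZL.exists_contDiff_approx (hε n)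
  have hDlim : ∀ y, Tendsto (fun n => D n y) atTop (𝓝 (Z y)) := fun y =>
    tendsto_iff_norm_sub_tendsto_zero.2 (squeeze_zero (fun n => norm_nonneg _)
      (fun n => hD3 n y) tendsto_one_div_add_atTop_nhds_zero_nat)
  have hF' : Continuous (deriv F) := hF.continuous_deriv le_rfl
  have hFc : HasCompactSupport F := HasCompactSupport.intro (isCompact_Icc (a := τ) (b := ρ))
    fun t ht => by
      rcases not_and_or.1 ht with h | h
      exacts [hFτ t (le_of_not_ge h), hFρ t (le_of_not_ge h)]
  obtain ⟨M1, hM1⟩ := hF'.bounded_above_of_compact_support hFc.deriv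
  obtain ⟨M2, hM2⟩ := hF.continuous.bounded_above_of_compact_support hFc
  have hη' : Continuous (fun y => ‖fderiv ℝ η y‖) := (hη.continuous_fderiv one_ne_zero).norm
  have hZp : Continuous fun y => Z y ^ (δ / 2) :=
    hZc.rpow_const fun _ => Or.inr (by positivity)
  have hZnn : ∀ y, 0 ≤ Z y := fun y => infDist_nonneg
  let A : ℕ → EuclideanSpace ℝ (Fin d) → ℝ≥0∞ := fun n y =>
    ENNReal.ofReal ((Z y ^ (δ / 2 - 1) * (η y * F (D n y))) ^ 2)
  let B : ℕ → EuclideanSpace ℝ (Fin d) → ℝ≥0∞ := fun n y =>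
    ENNReal.ofReal ((Z y ^ (δ / 2) *
      (|η y| * |deriv F (D n y)| + ‖fderiv ℝ η y‖ * |F (D n y)|)) ^ 2)
  have hAB : ∀ᶠ n in atTop, ∫⁻ y, A n y ≤ ENNReal.ofReal (a ^ 2) * ∫⁻ y, B n y := by
    have hsmall : ∀ᶠ n : ℕ in atTop, 1 / ((n : ℝ) + 1) < min τ (r - ρ) :=
      tendsto_one_div_add_atTop_nhds_zero_nat.eventually
        (gt_mem_nhds (lt_min hτ (sub_pos.2 hρ)))
    filter_upwards [hsmall] with n hn
    have hn1 := hn.trans_le (min_le_left _ _)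
    have hn2 := hn.trans_le (min_le_right _ _)
    let ψ : EuclideanSpace ℝ (Fin d) → ℝ := fun y => η y * F (D n y)
    have hsupp : tsupport ψ ⊆ {y | τ ≤ D n y ∧ D n y ≤ ρ} := by
      refine closure_minimal (fun y hy => ?_) ((isClosed_le continuous_const
        (hD1 n).continuous).inter (isClosed_le (hD1 n).continuous continuous_const))
      have h : F (D n y) ≠ 0 := right_ne_zero_of_mul hy
      exact ⟨le_of_not_ge fun h' => h (hFτ _ h'), le_of_not_ge fun h' => h (hFρ _ h')⟩
    have hsuppΩ : tsupport ψ ⊆ bdryLayer Ω r := by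
      intro y hy
      have h1 := hsupp hy
      have h2 := abs_le.1 (hD3 n y)
      have hyΩ : y ∈ Ω := by
        by_contra hcon
        have := hZ0 y hcon
        linarith [h1.1, h2.2]
      refine ⟨hyΩ, ?_⟩
      rw [hZd y hyΩ]
      linarith [h1.2, h2.1]
    have hψ : IsCc1 (bdryLayer Ω r) ψ :=
      ⟨hη.mul (hF.comp (hD1 n)), hηc.mul_right, hsuppΩ⟩
    have key := pow_le_pow_left' (hH ψ hψ) 2
    rw [mul_pow, wNorm, wGradNorm, L2N_sq, L2N_sq, ← ENNReal.ofReal_pow ha.le] at key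
    calc ∫⁻ y, A n y = ∫⁻ y, ENNReal.ofReal ((distB Ω y ^ (δ / 2 - 1) * ψ y) ^ 2) := by
          refine lintegral_congr fun y => ?_
          by_cases hy : y ∈ Ω
          · simp only [A, ψ, hZd y hy]
          · have : ψ y = 0 := image_eq_zero_of_notMem_tsupport fun h => hy (hsuppΩ h).1
            simp only [A, ψ] at *
            simp [this]
      _ ≤ _ := key
      _ ≤ _ := by
          refine mul_le_mul_right (lintegral_mono fun y => ?_) _
          by_cases hy : y ∈ Ω
          · refine ENNReal.ofReal_le_ofReal ?_
            rw [hZd y hy]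
            refine pow_le_pow_left₀ (by have := hZnn y; positivity)
              (mul_le_mul_of_nonneg_left ?_ (Real.rpow_nonneg (hZnn y) _)) 2
            have hd1 : HasFDerivAt (fun y => F (D n y))
                (deriv F (D n y) • fderiv ℝ (D n) y) y :=
              (hF.differentiable (by norm_num) _).hasDerivAt.comp_hasFDerivAt y
                ((hD1 n).differentiable (by norm_num) y).hasFDerivAt
            have hd2 := ((hη.differentiable (by norm_num) y).hasFDerivAt).mul hd1
            have hd3 : fderiv ℝ ψ y = _ := hd2.fderiv
            rw [hd3]
            refine (norm_add_le _ _).trans ?_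
            rw [norm_smul, norm_smul, norm_smul, Real.norm_eq_abs, Real.norm_eq_abs,
              Real.norm_eq_abs, mul_comm |F _|]
            gcongr
            refine mul_le_of_le_one_right (abs_nonneg _) ?_
            simpa using norm_fderiv_le_of_lipschitz ℝ (hD2 n) (x₀ := y)
          · have : fderiv ℝ ψ y = 0 := fderiv_of_notMem_tsupport ℝ fun h => hy (hsuppΩ h).1
            simp [this]
  have hAlim : ∀ y, Tendsto (fun n => A n y) atTop
      (𝓝 (ENNReal.ofReal ((Z y ^ (δ / 2 - 1) * (η y * F (Z y))) ^ 2))) := fun y =>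
    (ENNReal.continuous_ofReal.tendsto _).comp
      ((((((hF.continuous.tendsto _).comp (hDlim y)).const_mul _).const_mul _)).pow 2)
  have hBlim : ∀ y, Tendsto (fun n => B n y) atTop (𝓝 (ENNReal.ofReal ((Z y ^ (δ / 2) *
      (|η y| * |deriv F (Z y)| + ‖fderiv ℝ η y‖ * |F (Z y)|)) ^ 2))) := fun y =>
    (ENNReal.continuous_ofReal.tendsto _).comp
      (((((((hF'.tendsto _).comp (hDlim y)).abs.const_mul _).add
        (((hF.continuous.tendsto _).comp (hDlim y)).abs.const_mul _)).const_mul _)).pow 2)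
  have hAm : ∀ n, Measurable (A n) := fun n => by
    have h1 : Measurable (fun y => Z y ^ (δ / 2 - 1)) := hZc.measurable.pow_const _
    have h2 : Measurable (fun y => η y * F (D n y)) :=
      (hη.continuous.mul (hF.continuous.comp (hD1 n).continuous)).measurable
    exact ((h1.mul h2).pow_const 2).ennreal_ofReal
  have hBm : ∀ n, Measurable (B n) := fun n => by
    have h1 : Continuous (fun y => Z y ^ (δ / 2) *
      (|η y| * |deriv F (D n y)| + ‖fderiv ℝ η y‖ * |F (D n y)|)) :=
      hZp.mul ((hη.continuous.abs.mul (hF'.comp (hD1 n).continuous).abs).add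
        (hη'.mul (hF.continuous.comp (hD1 n).continuous).abs))
    exact (h1.pow 2).measurable.ennreal_ofReal
  let G : EuclideanSpace ℝ (Fin d) → ℝ := fun y =>
    (Z y ^ (δ / 2) * (|η y| * M1 + ‖fderiv ℝ η y‖ * M2)) ^ 2
  have hGi : Integrable G volume := by
    refine Continuous.integrable_of_hasCompactSupport ?_ (HasCompactSupport.intro hηc ?_)
    · exact (hZp.mul ((hη.continuous.abs.mul continuous_const).add
        (hη'.mul continuous_const))).pow 2
    · intro y hy
      simp [G, image_eq_zero_of_notMem_tsupport hy, fderiv_of_notMem_tsupport ℝ hy]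
  have hBG : ∀ n, B n ≤ᵐ[volume] fun y => ENNReal.ofReal (G y) := fun n =>
    Eventually.of_forall fun y => by
      refine ENNReal.ofReal_le_ofReal ?_
      have h1 : |deriv F (D n y)| ≤ M1 := hM1 _
      have h2 : |F (D n y)| ≤ M2 := hM2 _
      have h3 := hZnn y
      simp only [G]
      gcongr
  have hB := tendsto_lintegral_of_dominated_convergence _ hBm hBG hGi.lintegral_lt_top.ne
    (Eventually.of_forall hBlim)
  calc ∫⁻ y, ENNReal.ofReal ((Z y ^ (δ / 2 - 1) * (η y * F (Z y))) ^ 2)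
      = ∫⁻ y, liminf (fun n => A n y) atTop :=
        lintegral_congr fun y => (hAlim y).liminf_eq.symm
    _ ≤ liminf (fun n => ∫⁻ y, A n y) atTop := lintegral_liminf_le hAm
    _ ≤ liminf (fun n => ENNReal.ofReal (a ^ 2) * ∫⁻ y, B n y) atTop := liminf_le_liminf hAB
    _ = _ := (ENNReal.Tendsto.const_mul hB (Or.inr ENNReal.ofReal_ne_top)).liminf_eq

/-- Pointwise upper bound for the energy density of the test functions
`b ^ p * (d ^ (-(β + δ - 2) / 2) * u d)`, where `v` stands for the derivative of `u`. -/
lemma energy_density_le {β δ ε M b u v t m : ℝ} {p : ℕ} (hp : 1 ≤ p) (hβp : β ≤ p) (hε : 0 < ε)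
    (hM : 0 ≤ M) (ht0 : 0 < t) (ht1 : t ≤ 1) (hb0 : 0 ≤ b) (hu0 : 0 ≤ u) (hb1 : b ≤ 1)
    (hu1 : u ≤ 1) (hm0 : 0 ≤ m) (hm : m ≤ p * (b ^ (p - 1) * M)) :
    (t ^ (δ / 2) * (b ^ p * |-((β + δ - 2) / 2) * t ^ (-((β + δ - 2) / 2) - 1) * u
        + t ^ (-((β + δ - 2) / 2)) * v| + m * |t ^ (-((β + δ - 2) / 2)) * u|)) ^ 2 ≤
      (1 + ε) * (|β + δ - 2| / 2 + ε) ^ 2 *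
        (t ^ (δ / 2 - 1) * (b ^ p * (t ^ (-((β + δ - 2) / 2)) * u))) ^ 2
      + (1 + 1 / ε) * 2 * (t ^ (-β) * (t * v) ^ 2 + (p * M * (p * M / ε) ^ (p - 1)) ^ 2) := by
  have hG0 : 0 < t ^ (-((β + δ - 2) / 2)) := Real.rpow_pos_of_pos ht0 _
  have hT0 : 0 < t ^ (-(β / 2)) := Real.rpow_pos_of_pos ht0 _
  have e1 : t ^ (δ / 2 - 1) * t ^ (-((β + δ - 2) / 2)) = t ^ (-(β / 2)) := by
    rw [← Real.rpow_add ht0]; congr 1; ring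
  have e2 : t ^ (δ / 2) = t ^ (δ / 2 - 1) * t := by
    rw [Real.rpow_sub_one ht0.ne', div_mul_cancel₀ _ ht0.ne']
  have e3 : t ^ (-((β + δ - 2) / 2) - 1) = t ^ (-((β + δ - 2) / 2)) / t :=
    Real.rpow_sub_one ht0.ne' _
  have e4 : t ^ (-β) = (t ^ (-(β / 2))) ^ 2 := by
    rw [← Real.rpow_natCast, ← Real.rpow_mul ht0.le]; congr 1; push_cast; ring
  have e5 : t ^ (-(β / 2)) * t ^ p ≤ 1 := by
    rw [← Real.rpow_natCast, ← Real.rpow_add ht0]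
    have : (1 : ℝ) ≤ p := by exact_mod_cast hp
    exact Real.rpow_le_one ht0.le ht1 (by linarith)
  rw [e2, e3, e4]
  generalize t ^ (-((β + δ - 2) / 2)) = G at *
  generalize t ^ (-(β / 2)) = T at *
  generalize t ^ (δ / 2 - 1) = S at *
  generalize hg : (β + δ - 2) = g at *
  have hS0 : 0 < S := by
    by_contra hcon
    have := mul_nonpos_of_nonpos_of_nonneg (not_lt.1 hcon) hG0.le
    linarith
  set K := p * M * (p * M / ε) ^ (p - 1) with hK
  have hK0 : 0 ≤ K := by positivity
  have hcross : p * (b ^ (p - 1) * M) * t * u ≤ ε * b ^ p * u + K * t ^ p := by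
    have hbp : b ^ p = b ^ (p - 1) * b := (pow_sub_one_mul (by omega) b).symm
    have htp : t ^ p = t ^ (p - 1) * t := (pow_sub_one_mul (by omega) t).symm
    rcases le_total (p * M * t) (ε * b) with h | h
    · have h1 : p * (b ^ (p - 1) * M) * t * u ≤ ε * b ^ p * u := by
        calc p * (b ^ (p - 1) * M) * t * u = (p * M * t) * (b ^ (p - 1) * u) := by ring
          _ ≤ (ε * b) * (b ^ (p - 1) * u) := by gcongr
          _ = _ := by rw [hbp]; ring
      have : 0 ≤ K * t ^ p := by positivity
      linarith
    · have h2 : b ≤ p * M / ε * t := by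
        rw [div_mul_eq_mul_div, le_div_iff₀ hε]; linarith
      have h1 : p * (b ^ (p - 1) * M) * t * u ≤ K * t ^ p := by
        calc p * (b ^ (p - 1) * M) * t * u ≤ p * ((p * M / ε * t) ^ (p - 1) * M) * t * 1 := by
              gcongr
          _ = _ := by rw [hK, htp, mul_pow]; ring
      have : 0 ≤ ε * b ^ p * u := by positivity
      linarith
  have hfirst : |-(g / 2) * (G / t) * u + G * v| ≤ G / t * (|g| / 2 * u + |t * v|) := by
    have : -(g / 2) * (G / t) * u + G * v = G / t * (-(g / 2) * u + t * v) := by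
      field_simp
    rw [this, abs_mul, abs_of_pos (div_pos hG0 ht0)]
    refine mul_le_mul_of_nonneg_left ((abs_add_le _ _).trans_eq ?_) (by positivity)
    rw [abs_mul, abs_neg, abs_div, abs_two, abs_of_nonneg hu0]
  have hmain : S * t * (b ^ p * |-(g / 2) * (G / t) * u + G * v| + m * |G * u|) ≤
      T * ((|g| / 2 + ε) * (b ^ p * u)) + (T * |t * v| + K) := by
    calc S * t * (b ^ p * |-(g / 2) * (G / t) * u + G * v| + m * |G * u|)
        ≤ S * t * (b ^ p * (G / t * (|g| / 2 * u + |t * v|))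
          + p * (b ^ (p - 1) * M) * (G * u)) := by
          rw [abs_of_nonneg (mul_nonneg hG0.le hu0)]
          gcongr
      _ = (S * G) * (b ^ p * (|g| / 2 * u) + b ^ p * |t * v|
          + p * (b ^ (p - 1) * M) * t * u) := by
          field_simp
      _ ≤ T * (b ^ p * (|g| / 2 * u) + 1 * |t * v| + (ε * b ^ p * u + K * t ^ p)) := by
          rw [e1]
          gcongr
          exact pow_le_one₀ hb0 hb1
      _ = T * ((|g| / 2 + ε) * (b ^ p * u)) + (T * |t * v| + K * (T * t ^ p)) := by ring
      _ ≤ _ := by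
          gcongr
          exact mul_le_of_le_one_right hK0 e5
  have hyoung : ∀ X Y : ℝ, (X + Y) ^ 2 ≤ (1 + ε) * X ^ 2 + (1 + 1 / ε) * Y ^ 2 := by
    intro X Y
    have : (1 + ε) * X ^ 2 + (1 + 1 / ε) * Y ^ 2 - (X + Y) ^ 2 = (ε * X - Y) ^ 2 / ε := by
      field_simp; ring
    have h2 : 0 ≤ (ε * X - Y) ^ 2 / ε := by positivity
    linarith
  calc _ ≤ (T * ((|g| / 2 + ε) * (b ^ p * u)) + (T * |t * v| + K)) ^ 2 :=
        pow_le_pow_left₀ (by positivity) hmain 2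
    _ ≤ _ := hyoung _ _
    _ ≤ (1 + ε) * (T * ((|g| / 2 + ε) * (b ^ p * u))) ^ 2
        + (1 + 1 / ε) * (2 * ((T * |t * v|) ^ 2 + K ^ 2)) := by
        gcongr
        exact add_sq_le
    _ = _ := by
        rw [mul_pow T |t * v|, sq_abs, ← e1]; ring

/-- Divergence of `∫ d ^ (-β)` near the boundary, from the two-sided measure bounds. -/
lemma setLIntegral_rpow_neg_eq_top {α : Type*} [MeasurableSpace α] {μ : Measure α} {Z : α → ℝ}
    {S : Set α} (hS : ∀ y ∈ S, 0 < Z y) {β κ κ' t₀ : ℝ} (hβ : 0 < β)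
    (hκ' : 0 < κ') (ht₀ : 0 < t₀)
    (hm : ∀ t, MeasurableSet {y | y ∈ S ∧ Z y < t})
    (H : ∀ t ∈ Ioo 0 t₀, μ {y | y ∈ S ∧ Z y < t} ≤ ENNReal.ofReal (κ * t ^ β) ∧
      ENNReal.ofReal (κ' * t ^ β) ≤ μ {y | y ∈ S ∧ Z y < t}) {ρ : ℝ} (hρ : 0 < ρ) :
    ∫⁻ y in {y | y ∈ S ∧ Z y < ρ}, ENNReal.ofReal (Z y ^ (-β)) ∂μ = ∞ := by
  by_contra hfin
  have hlim : Tendsto (fun t => (μ.restrict {y | y ∈ S ∧ Z y < ρ}) {y | y ∈ S ∧ Z y < t})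
      (𝓝[>] 0) (𝓝 0) := by
    have h0 : Tendsto (fun t : ℝ => ENNReal.ofReal (κ * t ^ β)) (𝓝[>] 0) (𝓝 0) := by
      have : Tendsto (fun t : ℝ => ENNReal.ofReal (κ * t ^ β)) (𝓝 0)
          (𝓝 (ENNReal.ofReal (κ * 0 ^ β))) :=
        (ENNReal.continuous_ofReal.tendsto _).comp
          (((Real.continuousAt_rpow_const 0 β (Or.inr hβ.le)).tendsto).const_mul κ)
      rw [Real.zero_rpow hβ.ne', mul_zero, ENNReal.ofReal_zero] at this
      exact this.mono_left nhdsWithin_le_nhds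
    refine tendsto_of_tendsto_of_tendsto_of_le_of_le' tendsto_const_nhds h0
      (Eventually.of_forall fun _ => zero_le) ?_
    filter_upwards [Ioo_mem_nhdsGT ht₀] with t ht
      using (Measure.restrict_apply_le _ _).trans (H t ht).1
  have h1 := tendsto_setLIntegral_zero hfin hlim
  have h2 : ENNReal.ofReal κ' ≤ 0 := by
    refine ge_of_tendsto h1 ?_
    filter_upwards [Ioo_mem_nhdsGT ht₀, Ioo_mem_nhdsGT hρ] with t ht ht'
    have hsub : {y | y ∈ S ∧ Z y < t} ⊆ {y | y ∈ S ∧ Z y < ρ} :=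
      fun y hy => ⟨hy.1, hy.2.trans ht'.2⟩
    rw [Measure.restrict_restrict_of_subset hsub]
    calc ENNReal.ofReal κ' = ENNReal.ofReal (t ^ (-β)) * ENNReal.ofReal (κ' * t ^ β) := by
          rw [← ENNReal.ofReal_mul (Real.rpow_nonneg ht.1.le _), mul_left_comm,
            ← Real.rpow_add ht.1, neg_add_cancel, Real.rpow_zero, mul_one]
      _ ≤ ENNReal.ofReal (t ^ (-β)) * μ {y | y ∈ S ∧ Z y < t} := by
          gcongr; exact (H t ht).2
      _ = ∫⁻ y in {y | y ∈ S ∧ Z y < t}, ENNReal.ofReal (t ^ (-β)) ∂μ :=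
          (setLIntegral_const _ _).symm
      _ ≤ _ := setLIntegral_mono' (hm t) fun y hy => ENNReal.ofReal_le_ofReal
          (Real.rpow_le_rpow_of_nonpos (hS y hy.1) hy.2.le (by linarith))
  exact absurd h2 (by simpa using hκ')

lemma contDiff_rpow_mul_cutoff {u : ℝ → ℝ} (hu : ContDiff ℝ 1 u) {τ : ℝ} (hτ : 0 < τ)
    (huτ : ∀ t, t ≤ τ → u t = 0) (p : ℝ) : ContDiff ℝ 1 fun t => t ^ p * u t := by
  refine contDiff_iff_contDiffAt.2 fun t => ?_
  rcases lt_or_ge t τ with h | h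
  · refine (contDiffAt_const (c := (0 : ℝ))).congr_of_eventuallyEq ?_
    filter_upwards [Iio_mem_nhds h] with y hy
    rw [huτ y (le_of_lt hy), mul_zero]
  · exact (Real.contDiffAt_rpow_const_of_ne (hτ.trans_le h).ne').mul hu.contDiffAt

/-- If a boundary Hardy inequality holds with a constant `a` below the critical one, then
`∫ d ^ (-β)` over the region `2τ ≤ d ≤ ρ` near `x` is bounded uniformly in `τ`. -/
lemma BHardy.exists_setLIntegral_le {d : ℕ} (hd : 1 ≤ d) {Ω : Set (EuclideanSpace ℝ (Fin d))}
    (hΩ : IsOpen Ω) (hΩ' : Ω ≠ univ) {β δ r a ε : ℝ} (hβ0 : 0 < β) (hβ : β ≤ d) (hδ : 0 ≤ δ)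
    (ha : 0 < a) (hH : BHardy Ω δ (bdryLayer Ω r) a) (hε : 0 < ε)
    (hq : a ^ 2 * ((1 + ε) * (|β + δ - 2| / 2 + ε) ^ 2) < 1)
    {x : EuclideanSpace ℝ (Fin d)} {s κ t₀ ρ : ℝ} (hs : 0 < s) (_hκ : 0 < κ)
    (H : ∀ t ∈ Ioo 0 t₀, volume {y | y ∈ Ω ∧ dist y x < 3 * s ∧ infDist y Ωᶜ < t} ≤
      ENNReal.ofReal (κ * t ^ β))
    (hρ0 : 0 < ρ) (hρ1 : 2 * ρ ≤ 1) (hρr : 2 * ρ < r) :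
    ∃ L : ℝ≥0∞, L ≠ ∞ ∧ ∀ τ, 0 < τ → 3 * τ < t₀ →
      ∫⁻ y in {y | (y ∈ Ω ∧ dist y x < 2 * s ∧ infDist y Ωᶜ < ρ) ∧ 2 * τ ≤ infDist y Ωᶜ},
        ENNReal.ofReal (infDist y Ωᶜ ^ (-β)) ≤ L := by
  obtain ⟨C, hC, hcut⟩ := exists_cutoff
  set Z : EuclideanSpace ℝ (Fin d) → ℝ := fun y => infDist y Ωᶜ with hZ
  have hZc : Continuous Z := continuous_infDist_pt _
  have hZ0 : ∀ y, y ∉ Ω → Z y = 0 := fun y hy => infDist_zero_of_mem hy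
  have hZnn : ∀ y, 0 ≤ Z y := fun y => infDist_nonneg
  have hZpos : ∀ y ∈ Ω, 0 < Z y := fun y hy =>
    (hΩ.isClosed_compl.notMem_iff_infDist_pos (nonempty_compl.2 hΩ')).1 (by simpa using hy)
  let b : ContDiffBump x := ⟨2 * s, 5 / 2 * s, by positivity, by linarith⟩
  have hb1 : ContDiff ℝ 1 b := b.contDiff
  obtain ⟨M, hM⟩ := (hb1.continuous_fderiv one_ne_zero).bounded_above_of_compact_support
    (b.hasCompactSupport.fderiv (𝕜 := ℝ))
  have hM0 : 0 ≤ M := (norm_nonneg _).trans (hM x)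
  let η : EuclideanSpace ℝ (Fin d) → ℝ := fun y => b y ^ d
  have hη : ContDiff ℝ 1 η := hb1.pow d
  have hηz : ∀ y, y ∉ tsupport b → η y = 0 := fun y hy => by
    simp only [η, image_eq_zero_of_notMem_tsupport hy]
    exact zero_pow (by omega)
  have hηc : HasCompactSupport η := HasCompactSupport.intro b.hasCompactSupport hηz
  have hηn : ∀ y, 0 ≤ η y := fun y => pow_nonneg b.nonneg d
  have hη' : ∀ y, fderiv ℝ η y = ((d : ℝ) * b y ^ (d - 1)) • fderiv ℝ b y := fun y => by
    have := ((hb1.differentiable (by norm_num) y).hasFDerivAt.pow d).fderiv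
    rw [nsmul_eq_mul] at this
    exact this
  have hη'M : ∀ y, ‖fderiv ℝ η y‖ ≤ d * (b y ^ (d - 1) * M) := fun y => by
    have h0 : 0 ≤ b y := b.nonneg
    rw [hη', norm_smul, Real.norm_eq_abs, abs_of_nonneg (by positivity), mul_assoc]
    gcongr
    exact hM y
  have hη'z : ∀ y, y ∉ tsupport b → fderiv ℝ η y = 0 := fun y hy => by
    rw [hη', fderiv_of_notMem_tsupport ℝ hy, smul_zero]
  have hball : ∀ y, y ∈ tsupport b → dist y x < 3 * s := fun y hy => by
    rw [b.tsupport_eq] at hy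
    have : dist y x ≤ 5 / 2 * s := hy
    linarith
  set q := (1 + ε) * (|β + δ - 2| / 2 + ε) ^ 2 with hqdef
  have hq0 : 0 ≤ q := by positivity
  set K := d * M * (d * M / ε) ^ (d - 1) with hK
  set P := (1 + 1 / ε) * 2 with hP
  have hP0 : 0 ≤ P := by positivity
  set N : ℝ := P * (C ^ 2 * (κ * 3 ^ β)) with hN
  set N' : ℝ := P * (C ^ 2 * ρ ^ (-β) + K ^ 2) with hN'
  let L₀ : ℝ≥0∞ := ENNReal.ofReal N + ENNReal.ofReal N' * volume (ball x (3 * s))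
  have hL₀ : L₀ ≠ ∞ := by
    have : volume (ball x (3 * s)) ≠ ∞ := measure_ball_lt_top.ne
    simp only [L₀]
    finiteness
  have hq1 : ENNReal.ofReal (a ^ 2 * q) < 1 := by
    rw [← ENNReal.ofReal_one]
    exact (ENNReal.ofReal_lt_ofReal_iff one_pos).2 hq
  refine ⟨ENNReal.ofReal (a ^ 2) * L₀ / (1 - ENNReal.ofReal (a ^ 2 * q)),
    ENNReal.div_ne_top (ENNReal.mul_ne_top ENNReal.ofReal_ne_top hL₀)
      (tsub_pos_of_lt hq1).ne', fun τ hτ hτt => ?_⟩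
  obtain ⟨u, hu, hu0, hu1, huτ, huρ, hueq, huC, husupp⟩ := hcut τ ρ hτ hρ0
  set g := (β + δ - 2) / 2 with hg
  let F : ℝ → ℝ := fun t => t ^ (-g) * u t
  have hF : ContDiff ℝ 1 F := contDiff_rpow_mul_cutoff hu hτ huτ _
  have hFτ : ∀ t, t ≤ τ → F t = 0 := fun t ht => by simp [F, huτ t ht]
  have hFρ : ∀ t, 2 * ρ ≤ t → F t = 0 := fun t ht => by simp [F, huρ t ht]
  have hF' : ∀ t, 0 < t → deriv F t = -g * t ^ (-g - 1) * u t + t ^ (-g) * deriv u t :=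
    fun t ht => ((Real.hasDerivAt_rpow_const (Or.inl ht.ne')).mul
      (hu.differentiable (by norm_num) t).hasDerivAt).deriv
  have hF'0 : ∀ t, t < τ → deriv F t = 0 := fun t ht => by
    have : F =ᶠ[𝓝 t] fun _ => (0 : ℝ) := by
      filter_upwards [Iio_mem_nhds ht] with y hy using hFτ y (le_of_lt hy)
    rw [this.deriv_eq, deriv_const]
  have hF'1 : ∀ t, 2 * ρ < t → deriv F t = 0 := fun t ht => by
    have : F =ᶠ[𝓝 t] fun _ => (0 : ℝ) := by
      filter_upwards [Ioi_mem_nhds ht] with y hy using hFρ y (le_of_lt hy)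
    rw [this.deriv_eq, deriv_const]
  let h : EuclideanSpace ℝ (Fin d) → ℝ := fun y => (Z y ^ (δ / 2 - 1) * (η y * F (Z y))) ^ 2
  let I : ℝ≥0∞ := ∫⁻ y, ENNReal.ofReal (h y)
  have hHardy : I ≤ ENNReal.ofReal (a ^ 2) * ∫⁻ y, ENNReal.ofReal ((Z y ^ (δ / 2) *
        (|η y| * |deriv F (Z y)| + ‖fderiv ℝ η y‖ * |F (Z y)|)) ^ 2) :=
    hH.comp_infDist_le hΩ' hδ ha hF hτ hρr hFτ hFρ hη hηc
  have hh : ∀ y, 0 < Z y → h y = Z y ^ (-β) * (η y * u (Z y)) ^ 2 := fun y hy => by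
    have e1 : Z y ^ (δ / 2 - 1) * Z y ^ (-g) = Z y ^ (-(β / 2)) := by
      rw [← Real.rpow_add hy]; congr 1; rw [hg]; ring
    have e2 : Z y ^ (-β) = (Z y ^ (-(β / 2))) ^ 2 := by
      rw [← Real.rpow_natCast, ← Real.rpow_mul hy.le]; congr 1; push_cast; ring
    simp only [h, F]
    rw [e2, ← e1]; ring
  have hu_bd : ∀ t, 0 < t → t ^ (-β) * u t ^ 2 ≤ τ ^ (-β) := fun t ht => by
    rcases le_total t τ with h1 | h1
    · rw [huτ t h1]; simp; positivity
    · calc t ^ (-β) * u t ^ 2 ≤ τ ^ (-β) * 1 :=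
            mul_le_mul (Real.rpow_le_rpow_of_nonpos hτ h1 (by linarith))
              (pow_le_one₀ (hu0 t) (hu1 t)) (sq_nonneg _) (by positivity)
        _ = _ := mul_one _
  have hηle : ∀ y, η y ≤ 1 := fun y => pow_le_one₀ b.nonneg b.le_one
  have hh_bd : ∀ y, h y ≤ (ball x (3 * s)).indicator (fun _ => τ ^ (-β)) y := fun y => by
    by_cases hyb : y ∈ tsupport b
    · rw [indicator_of_mem (mem_ball.2 (hball y hyb))]
      rcases (hZnn y).eq_or_lt with h0 | h0
      · simp only [h, ← h0, hFτ 0 hτ.le]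
        simp; positivity
      · rw [hh y h0, mul_pow]
        calc Z y ^ (-β) * (η y ^ 2 * u (Z y) ^ 2) = η y ^ 2 * (Z y ^ (-β) * u (Z y) ^ 2) := by ring
          _ ≤ 1 * τ ^ (-β) := by
            gcongr
            · exact pow_le_one₀ (hηn y) (hηle y)
            · exact hu_bd _ h0
          _ = _ := one_mul _
    · simp only [h, hηz y hyb]
      simp only [zero_mul, mul_zero, ne_eq, OfNat.ofNat_ne_zero, not_false_eq_true, zero_pow]
      exact indicator_nonneg (fun _ _ => by positivity) _
  have hI : I ≠ ∞ := by
    refine ((lintegral_mono fun y => ENNReal.ofReal_le_ofReal (hh_bd y)).trans_lt ?_).ne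
    have : ∀ y, ENNReal.ofReal ((ball x (3 * s)).indicator (fun _ => τ ^ (-β)) y)
        = (ball x (3 * s)).indicator (fun _ => ENNReal.ofReal (τ ^ (-β))) y := fun y => by
      by_cases hy : y ∈ ball x (3 * s) <;> simp [hy]
    simp_rw [this]
    rw [lintegral_indicator measurableSet_ball, setLIntegral_const]
    exact ENNReal.mul_lt_top ENNReal.ofReal_lt_top measure_ball_lt_top
  let W : Set (EuclideanSpace ℝ (Fin d)) := {y | y ∈ Ω ∧ dist y x < 3 * s ∧ Z y < 3 * τ}
  have hWm : MeasurableSet W :=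
    (hΩ.inter ((isOpen_lt (f := fun y => dist y x) (by fun_prop) continuous_const).inter
      (isOpen_lt hZc continuous_const))).measurableSet
  have hpt : ∀ y, ENNReal.ofReal ((Z y ^ (δ / 2) *
      (|η y| * |deriv F (Z y)| + ‖fderiv ℝ η y‖ * |F (Z y)|)) ^ 2) ≤
      ENNReal.ofReal q * ENNReal.ofReal (h y) +
      (W.indicator (fun _ => ENNReal.ofReal (P * (C ^ 2 * τ ^ (-β)))) y +
        (ball x (3 * s)).indicator (fun _ => ENNReal.ofReal N') y) := fun y => by
    by_cases htriv : y ∉ tsupport b ∨ Z y < τ ∨ 2 * ρ < Z y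
    · refine le_trans (le_of_eq ?_) zero_le
      rcases htriv with h1 | h1 | h1
      · simp [hηz y h1, hη'z y h1]
      · simp [hF'0 _ h1, hFτ _ h1.le]
      · simp [hF'1 _ h1, hFρ _ h1.le]
    · push Not at htriv
      obtain ⟨hyb, hZτ, hZρ⟩ := htriv
      have hZ0' : 0 < Z y := hτ.trans_le hZτ
      have hyΩ : y ∈ Ω := by
        by_contra hcon
        exact hZ0'.ne' (hZ0 y hcon)
      have hyx := hball y hyb
      have key := energy_density_le (v := deriv u (Z y)) (δ := δ) hd hβ hε hM0 hZ0'
        (hZρ.trans hρ1) (b.nonneg (x := y)) (hu0 (Z y)) (b.le_one (x := y)) (hu1 (Z y))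
        (norm_nonneg _) (hη'M y)
      rw [← hF' _ hZ0', ← hqdef, ← hK, ← hP] at key
      have hsq : (Z y * deriv u (Z y)) ^ 2 ≤ C ^ 2 := by
        rw [← sq_abs]; exact pow_le_pow_left₀ (abs_nonneg _) (huC _ hZ0') 2
      have hZβ : Z y ^ (-β) * (Z y * deriv u (Z y)) ^ 2 ≤
          W.indicator (fun _ => C ^ 2 * τ ^ (-β)) y + C ^ 2 * ρ ^ (-β) := by
        have hWnn : 0 ≤ W.indicator (fun _ => C ^ 2 * τ ^ (-β)) y :=
          indicator_nonneg (fun _ _ => by positivity) _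
        by_cases hd0 : deriv u (Z y) = 0
        · rw [hd0]; simp only [mul_zero, ne_eq, OfNat.ofNat_ne_zero, not_false_eq_true, zero_pow]
          positivity
        · rcases husupp _ hd0 with h1 | h1
          · rw [indicator_of_mem (show y ∈ W from ⟨hyΩ, hyx, by linarith [h1.2]⟩)]
            have : Z y ^ (-β) * (Z y * deriv u (Z y)) ^ 2 ≤ τ ^ (-β) * C ^ 2 :=
              mul_le_mul (Real.rpow_le_rpow_of_nonpos hτ h1.1 (by linarith)) hsq (sq_nonneg _)
                (by positivity)
            have : 0 ≤ C ^ 2 * ρ ^ (-β) := by positivity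
            linarith
          · have : Z y ^ (-β) * (Z y * deriv u (Z y)) ^ 2 ≤ ρ ^ (-β) * C ^ 2 :=
              mul_le_mul (Real.rpow_le_rpow_of_nonpos hρ0 h1.1 (by linarith)) hsq (sq_nonneg _)
                (by positivity)
            linarith
      rw [indicator_of_mem (mem_ball.2 hyx)]
      have hWi : W.indicator (fun _ => ENNReal.ofReal (P * (C ^ 2 * τ ^ (-β)))) y
          = ENNReal.ofReal (P * W.indicator (fun _ => C ^ 2 * τ ^ (-β)) y) := by
        by_cases hy : y ∈ W <;> simp [hy]
      have hWnn : 0 ≤ W.indicator (fun _ => C ^ 2 * τ ^ (-β)) y :=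
        indicator_nonneg (fun _ _ => by positivity) _
      rw [hWi, ← ENNReal.ofReal_mul hq0, ← ENNReal.ofReal_add (by positivity) (by positivity),
        ← ENNReal.ofReal_add (by positivity) (by positivity)]
      refine ENNReal.ofReal_le_ofReal ?_
      rw [abs_of_nonneg (hηn y)]
      refine key.trans ?_
      have := mul_le_mul_of_nonneg_left hZβ hP0
      simp only [h, η, F, hN']
      linarith
  have hupper : ∫⁻ y, ENNReal.ofReal ((Z y ^ (δ / 2) *
      (|η y| * |deriv F (Z y)| + ‖fderiv ℝ η y‖ * |F (Z y)|)) ^ 2) ≤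
      ENNReal.ofReal q * I + L₀ := by
    have hhm : Measurable h := by
      have h1 : Measurable (fun y => Z y ^ (δ / 2 - 1)) := hZc.measurable.pow_const _
      exact (h1.mul (hη.continuous.mul (hF.continuous.comp hZc)).measurable).pow_const 2
    refine (lintegral_mono hpt).trans ?_
    rw [lintegral_add_left (hhm.ennreal_ofReal.const_mul _),
      lintegral_const_mul _ hhm.ennreal_ofReal,
      lintegral_add_left (measurable_const.indicator hWm), lintegral_indicator hWm,
      lintegral_indicator measurableSet_ball, setLIntegral_const, setLIntegral_const]
    refine add_le_add_right (add_le_add_left ?_ _) _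
    calc ENNReal.ofReal (P * (C ^ 2 * τ ^ (-β))) * volume W
        ≤ ENNReal.ofReal (P * (C ^ 2 * τ ^ (-β))) * ENNReal.ofReal (κ * (3 * τ) ^ β) := by
          gcongr
          exact H _ ⟨by positivity, hτt⟩
      _ = ENNReal.ofReal N := by
          rw [← ENNReal.ofReal_mul (by positivity), Real.mul_rpow (by norm_num) hτ.le, hN]
          congr 1
          have : τ ^ (-β) * τ ^ β = 1 := by
            rw [← Real.rpow_add hτ, neg_add_cancel, Real.rpow_zero]
          linear_combination P * C ^ 2 * κ * 3 ^ β * this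
  have hIle : I ≤ ENNReal.ofReal (a ^ 2) * L₀ / (1 - ENNReal.ofReal (a ^ 2 * q)) := by
    rw [ENNReal.le_div_iff_mul_le (Or.inl (tsub_pos_of_lt hq1).ne')
        (Or.inl (ENNReal.sub_ne_top ENNReal.one_ne_top)),
      ENNReal.mul_sub (fun _ _ => hI), mul_one]
    rw [tsub_le_iff_left]
    refine hHardy.trans ((mul_le_mul_right hupper _).trans_eq ?_)
    rw [ENNReal.ofReal_mul (p := a ^ 2) (q := q) (by positivity)]
    ring
  refine le_trans ?_ hIle
  have hVm : MeasurableSet {y | (y ∈ Ω ∧ dist y x < 2 * s ∧ Z y < ρ) ∧ 2 * τ ≤ Z y} :=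
    (hΩ.inter ((isOpen_lt (f := fun y => dist y x) (by fun_prop) continuous_const).inter
      (isOpen_lt hZc continuous_const))).measurableSet.inter
      (isClosed_le continuous_const hZc).measurableSet
  refine (setLIntegral_mono' hVm fun y hy => ?_).trans (setLIntegral_le_lintegral _ _)
  have hby : b y = 1 := b.one_of_mem_closedBall (mem_closedBall.2 hy.1.2.1.le)
  rw [hh y (hZpos y hy.1.1), hueq _ hy.2 hy.1.2.2.le]
  simp [η, hby, hZ]

lemma BHardy.two_div_abs_le {d : ℕ} (hd : 1 ≤ d) {Ω : Set (EuclideanSpace ℝ (Fin d))}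
    (hΩ : IsOpen Ω) (hΩ' : Ω ≠ univ) {β δ r a : ℝ} (hβ0 : 0 < β) (hβ : β ≤ d)
    {x : EuclideanSpace ℝ (Fin d)} (hx : AhlforsPoint Ω β x) (hδ : 0 ≤ δ) (hδβ : δ ≠ 2 - β)
    (hr : 0 < r) (ha : 0 < a) (hH : BHardy Ω δ (bdryLayer Ω r) a) :
    2 / |β + δ - 2| ≤ a := by
  by_contra! hlt
  have hg : 0 < |β + δ - 2| := abs_pos.2 fun h => hδβ (by linarith)
  obtain ⟨ε, hε, hq⟩ : ∃ ε > 0, a ^ 2 * ((1 + ε) * (|β + δ - 2| / 2 + ε) ^ 2) < 1 := by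
    have h1 : a * (|β + δ - 2| / 2) < 1 := by
      rw [lt_div_iff₀ hg] at hlt
      linarith
    have h2 : a ^ 2 * ((1 + 0) * (|β + δ - 2| / 2 + 0) ^ 2) < 1 := by
      have := pow_lt_one₀ (by positivity) h1 two_ne_zero
      linarith [mul_pow a (|β + δ - 2| / 2) 2]
    have hc : Continuous fun ε : ℝ => a ^ 2 * ((1 + ε) * (|β + δ - 2| / 2 + ε) ^ 2) := by fun_prop
    have h3 := (hc.tendsto 0).eventually (gt_mem_nhds h2)
    obtain ⟨ε, hε, hε0⟩ := ((h3.filter_mono nhdsWithin_le_nhds).and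
      (self_mem_nhdsWithin (s := Ioi (0 : ℝ)))).exists
    exact ⟨ε, hε0, hε⟩
  obtain ⟨s, κ, κ', t₀, hs, hκ, hκ', ht₀, H⟩ := hx.exists_measure_bounds hβ0
  have hset : ∀ c t : ℝ, {y | y ∈ Ω ∧ dist y x < c ∧ distB Ω y < t} =
      {y | y ∈ Ω ∧ dist y x < c ∧ infDist y Ωᶜ < t} := fun c t => by
    ext y
    simp only [mem_ofPred_eq]
    refine and_congr_right fun hy => ?_
    rw [infDist_compl_eq_infDist_frontier hΩ' hy, distB]
  simp only [hset] at H
  obtain ⟨ρ, hρ0, hρ⟩ := exists_between (show (0 : ℝ) < min (1 / 2) (r / 2) by positivity)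
  obtain ⟨hρ1, hρr⟩ := lt_min_iff.1 hρ
  obtain ⟨L, hL, hLle⟩ := hH.exists_setLIntegral_le hd hΩ hΩ' hβ0 hβ hδ ha hε hq hs hκ
    (fun t ht => (H t ht).1) hρ0 (by linarith) (by linarith)
  have hZpos : ∀ y ∈ Ω, 0 < infDist y Ωᶜ := fun y hy =>
    (hΩ.isClosed_compl.notMem_iff_infDist_pos (nonempty_compl.2 hΩ')).1 (by simpa using hy)
  have hset' : ∀ t : ℝ, {y | y ∈ {y | y ∈ Ω ∧ dist y x < 2 * s} ∧ infDist y Ωᶜ < t} =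
      {y | y ∈ Ω ∧ dist y x < 2 * s ∧ infDist y Ωᶜ < t} := fun t => by
    ext y
    simp only [mem_ofPred_eq, and_assoc]
  have htop := setLIntegral_rpow_neg_eq_top (μ := volume) (Z := fun y => infDist y Ωᶜ)
    (S := {y | y ∈ Ω ∧ dist y x < 2 * s}) (fun y hy => hZpos y hy.1) (κ := κ) hβ0 hκ' ht₀
    (fun t => ((hΩ.inter (isOpen_lt (f := fun y => dist y x) (by fun_prop)
      continuous_const)).inter (isOpen_lt (continuous_infDist_pt _)
        continuous_const)).measurableSet)
    (fun t ht => by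
      rw [hset']
      have hsub : {y | y ∈ Ω ∧ dist y x < 2 * s ∧ infDist y Ωᶜ < t} ⊆
          {y | y ∈ Ω ∧ dist y x < 3 * s ∧ infDist y Ωᶜ < t} :=
        fun y hy => ⟨hy.1, by linarith [hy.2.1], hy.2.2⟩
      exact ⟨(measure_mono hsub).trans (H t ht).1, (H t ht).2⟩) hρ0
  rw [hset'] at htop
  let V : ℕ → Set (EuclideanSpace ℝ (Fin d)) := fun n =>
    {y | (y ∈ Ω ∧ dist y x < 2 * s ∧ infDist y Ωᶜ < ρ) ∧ 2 * (t₀ / 4 / (n + 1)) ≤ infDist y Ωᶜ}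
  have hV : {y | y ∈ Ω ∧ dist y x < 2 * s ∧ infDist y Ωᶜ < ρ} = ⋃ n, V n := by
    refine subset_antisymm (fun y hy => mem_iUnion.2 ?_) (iUnion_subset fun n y hy => hy.1)
    have hlim : Tendsto (fun n : ℕ => 2 * (t₀ / 4 / ((n : ℝ) + 1))) atTop (𝓝 0) := by
      have := (tendsto_one_div_add_atTop_nhds_zero_nat (𝕜 := ℝ)).const_mul (2 * (t₀ / 4))
      rw [mul_zero] at this
      exact this.congr fun n => by ring
    obtain ⟨n, hn⟩ := (hlim.eventually (gt_mem_nhds (hZpos y hy.1))).exists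
    exact ⟨n, hy, hn.le⟩
  have hVmono : Monotone V := fun m n hmn y hy => by
    refine ⟨hy.1, le_trans ?_ hy.2⟩
    gcongr
  rw [hV, setLIntegral_iUnion_of_directed _ hVmono.directed_le] at htop
  refine hL (top_le_iff.1 (htop ▸ iSup_le fun n => hLle _ (by positivity) ?_))
  have : t₀ / 4 / ((n : ℝ) + 1) ≤ t₀ / 4 :=
    div_le_self (by positivity) (by linarith [n.cast_nonneg (α := ℝ)])
  linarith

/-- If `Γ` contains an Ahlfors point with exponent `β ∈ (0,d]` and `δ ≥ 0`
with `δ ≠ 2-β`, then any constant `a > 0` for which the boundary Hardy inequality holds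
on some `Γ_r` satisfies `a ≥ 2/|β+δ-2|`; in particular `a_δ(Γ) ≥ 2/|β+δ-2|`. -/
theorem stmt8 {d : ℕ} (hd : 1 ≤ d) (Ω : Set (EuclideanSpace ℝ (Fin d)))
    (hΩ : IsDomainSet Ω) (β : ℝ) (hβ : β ∈ Set.Ioc (0:ℝ) (d:ℝ))
    (x : EuclideanSpace ℝ (Fin d)) (hx : AhlforsPoint Ω β x)
    (δ : ℝ) (hδ0 : 0 ≤ δ) (hδβ : δ ≠ 2 - β)
    (r a : ℝ) (hr : 0 < r) (ha : 0 < a)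
    (hH : BHardy Ω δ (bdryLayer Ω r) a) :
    2 / |β + δ - 2| ≤ a ∧
    ENNReal.ofReal (2 / |β + δ - 2|) ≤ hardyConst Ω δ := by
  refine ⟨hH.two_div_abs_le hd hΩ.1 hΩ.2.2 hβ.1 hβ.2 hx hδ0 hδβ hr ha, ?_⟩
  refine le_iInf₂ fun r' hr' => le_sInf ?_
  rintro _ ⟨a', ha', rfl, hH'⟩
  exact ENNReal.ofReal_le_ofReal
    (hH'.two_div_abs_le hd hΩ.1 hΩ.2.2 hβ.1 hβ.2 hx hδ0 hδβ hr' ha')
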